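/- A nonnegative integer n is represented by the quaternary quadratic form x₁² + 2x₂² + 32y₁² + 64y₂² if and only if n ≡ 0, 1 or 3 (mod 8), or n ≡ 2 or 6 (mod 16), or n ≡ 4 or 12 (mod 32). (This is the regularity of the binary Hermitian lattice ⟨1,32⟩ over ℚ(√-2), stated for its associated quadratic form.) -/

import Mathlib

/-- The integer `n` is represented by a positive definite integral ternary form
`a x² + b y² + c z² + 2 d x y + 2 e x z + 2 f y z` of determinant one, where `A = a b - d²`. -/
def RepByUnimodularTernary (n a A : ℤ) : Prop :=
  ∃ b c d e f x y z : ℤ, 0 < a ∧ 0 < A ∧ a * b - d ^ 2 = A ∧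
    a * b * c + 2 * d * e * f - a * f ^ 2 - b * e ^ 2 - c * d ^ 2 = 1 ∧
    a * x ^ 2 + b * y ^ 2 + c * z ^ 2 + 2 * d * x * y + 2 * e * x * z + 2 * f * y * z = n

/-- Centered division with remainder. -/
theorem exists_two_mul_abs_add_mul_le (a d : ℤ) (ha : 0 < a) :
    ∃ k : ℤ, 2 * (d + k * a) ≤ a ∧ -a ≤ 2 * (d + k * a) := by
  have h₁ := Int.emod_add_mul_ediv d a
  have h₂ := Int.emod_nonneg d ha.ne'
  have h₃ := Int.emod_lt_of_pos d ha
  by_cases h : 2 * (d % a) ≤ a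
  · exact ⟨-(d / a), by nlinarith, by nlinarith⟩
  · exact ⟨-(d / a) - 1, by nlinarith, by nlinarith⟩

theorem Int.exists_least_pos {P : ℤ → Prop} (hP : ∀ a, P a → 0 < a) (h : ∃ a, P a) :
    ∃ a, P a ∧ ∀ b, P b → a ≤ b := by
  obtain ⟨a, ha, hmin⟩ := Int.exists_least_of_bdd ⟨0, fun z hz => (hP z hz).le⟩ h
  exact ⟨a, ha, hmin⟩

theorem eq_one_and_eq_one_of_three_mul_sq_le {a b : ℤ} (ha : 0 < a) (hb : 0 < b)
    (hab : 3 * a ^ 2 ≤ 4 * b) (hba : 3 * b ^ 2 ≤ 4 * a) : a = 1 ∧ b = 1 := by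
  have h₁ : a < 2 := by nlinarith
  have h₂ : b < 2 := by nlinarith
  omega

/-- An integer represented by a positive definite integral ternary form of determinant one
is a sum of three squares. -/
theorem RepByUnimodularTernary.exists_sum_three_sq {n a A : ℤ}
    (h : RepByUnimodularTernary n a A) : ∃ x y z : ℤ, x ^ 2 + y ^ 2 + z ^ 2 = n := by
  obtain ⟨a, ⟨A, hA⟩, ha_min⟩ :=
    Int.exists_least_pos (P := fun a => ∃ A, RepByUnimodularTernary n a A)
      (fun a ⟨A, hA⟩ => by obtain ⟨_, _, _, _, _, _, _, _, h, _⟩ := hA; exact h) ⟨a, A, h⟩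
  obtain ⟨A, hA, hA_min⟩ :=
    Int.exists_least_pos (P := fun A => RepByUnimodularTernary n a A)
      (fun A hA => by obtain ⟨_, _, _, _, _, _, _, _, _, h, _⟩ := hA; exact h) ⟨A, hA⟩
  obtain ⟨b, c, d, e, f, x, y, z, ha, hA0, hAd, hdet, hn⟩ := hA
  obtain ⟨k, hk₁, hk₂⟩ := exists_two_mul_abs_add_mul_le a d ha
  obtain ⟨l, hl₁, hl₂⟩ := exists_two_mul_abs_add_mul_le A (a * f - d * e) hA0
  obtain ⟨d', hd'⟩ : ∃ d', d' = d + k * a := ⟨_, rfl⟩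
  obtain ⟨b', hb'⟩ : ∃ b', b' = b + 2 * k * d + k ^ 2 * a := ⟨_, rfl⟩
  obtain ⟨B, hB⟩ : ∃ B, B = a * f - d * e + l * A := ⟨_, rfl⟩
  obtain ⟨c', hc'⟩ : ∃ c', c' = c + 2 * l * f + l ^ 2 * b := ⟨_, rfl⟩
  obtain ⟨e', he'⟩ : ∃ e', e' = e + l * d := ⟨_, rfl⟩
  obtain ⟨f', hf'⟩ : ∃ f', f' = f + l * b := ⟨_, rfl⟩
  rw [← hd'] at hk₁ hk₂
  rw [← hB] at hl₁ hl₂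
  have hA' : a * b' - d' ^ 2 = A := by rw [← hAd, hb', hd']; ring
  have hb'_pos : 0 < b' := by nlinarith [sq_nonneg d']
  have hab : a ≤ b' := by
    refine ha_min b' ⟨A, a, c, d', f + k * e, e, y, x - k * y, z, hb'_pos, hA0, ?_, ?_, ?_⟩
    · rw [← hA']; ring
    · rw [← hdet, hb', hd']; ring
    · rw [← hn, hb', hd']; ring
  have hdet' : a * b * c' + 2 * d * e' * f' - a * f' ^ 2 - b * e' ^ 2 - c' * d ^ 2 = 1 := by
    rw [← hdet, hc', he', hf']; ring
  obtain ⟨C, hC⟩ : ∃ C, C = a * c' - e' ^ 2 := ⟨_, rfl⟩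
  have hB' : B = a * f' - d * e' := by rw [hB, hf', he', ← hAd]; ring
  have hAC : A * C = a + B ^ 2 := by
    have : A * C - B ^ 2 =
        a * (a * b * c' + 2 * d * e' * f' - a * f' ^ 2 - b * e' ^ 2 - c' * d ^ 2) := by
      rw [hB', hC, ← hAd]; ring
    rw [hdet'] at this
    linarith
  have hC_pos : 0 < C := by nlinarith [sq_nonneg B]
  have hAC_le : A ≤ C := by
    refine hA_min C ⟨c', b, e', d, f', x, z, y - l * z, ha, hC_pos, hC.symm, ?_, ?_⟩
    · rw [← hdet']; ring
    · rw [← hn, hc', he', hf']; ring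
  have hB_sq : (2 * B) ^ 2 ≤ A ^ 2 := sq_le_sq' hl₂ hl₁
  have hd_sq : (2 * d') ^ 2 ≤ a ^ 2 := sq_le_sq' hk₂ hk₁
  have hAa : 3 * A ^ 2 ≤ 4 * a := by
    linarith [mul_le_mul_of_nonneg_left hAC_le hA0.le]
  have haA : 3 * a ^ 2 ≤ 4 * A := by
    linarith [mul_le_mul_of_nonneg_left hab ha.le]
  obtain ⟨rfl, rfl⟩ := eq_one_and_eq_one_of_three_mul_sq_le ha hA0 haA hAa
  have hB_zero : B = 0 := by omega
  have hC_one : C = 1 := by rw [hB_zero] at hAC; linarith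
  refine ⟨x + d * (y - l * z) + e' * z, y - l * z, z, ?_⟩
  have hb : b = 1 + d ^ 2 := by linarith
  have hf : f' = d * e' := by linarith
  have hc : c' = 1 + e' ^ 2 := by linarith
  calc _ = x ^ 2 + (1 + d ^ 2) * (y - l * z) ^ 2 + (1 + e' ^ 2) * z ^ 2 + 2 * d * x * (y - l * z)
        + 2 * e' * x * z + 2 * (d * e') * (y - l * z) * z := by ring
    _ = n := by rw [← hn, ← hb, ← hc, ← hf, hc', hf', he']; ring

/-- If `-d` is a square modulo `d n - 1`, then `n` is a sum of three squares. -/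
theorem exists_sum_three_sq_of_dvd {n d s : ℤ} (hd : 0 < d) (hn : 0 < d * n - 1)
    (h : d * n - 1 ∣ s ^ 2 + d) : ∃ x y z : ℤ, x ^ 2 + y ^ 2 + z ^ 2 = n := by
  obtain ⟨a, ha⟩ := h
  refine RepByUnimodularTernary.exists_sum_three_sq (a := a) (A := d)
    ⟨d * n - 1, n, s, 1, 0, 0, 0, 1, ?_, hd, ?_, ?_, ?_⟩
  · exact pos_of_mul_pos_right (by nlinarith [sq_nonneg s]) hn.le
  · linarith
  · linear_combination (-n) * ha
  · ring

open scoped NumberTheorySymbols in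
theorem jacobiSym_neg_eq_one {p d n : ℕ} (hp : p % 4 = 1) (hd : d % 8 = 1 ∨ d % 8 = 3)
    (h : 2 * p + 1 = d * n) : J(-(d : ℤ) | p) = 1 := by
  have hp_odd : Odd p := Nat.odd_iff.2 (by omega)
  have hd_odd : Odd d := Nat.odd_iff.2 (by omega)
  have h_two : J(-2 | d) = 1 := by
    rw [jacobiSym.at_neg_two hd_odd, ZMod.χ₈'_nat_eq_if_mod_eight]
    rcases hd with hd | hd <;> simp [hd] <;> omega
  have h_mul : J(-2 * (p : ℤ) | d) = 1 := by
    rw [jacobiSym.mod_left' (a₂ := 1), jacobiSym.one_left]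
    refine Int.ModEq.symm ((Int.modEq_iff_dvd).2 ⟨-(n : ℤ), ?_⟩)
    push_cast [← Int.natCast_inj] at h
    linarith
  rw [jacobiSym.mul_left, h_two, one_mul] at h_mul
  rw [jacobiSym.neg _ hp_odd, ZMod.χ₄_nat_one_mod_four hp, one_mul,
    ← jacobiSym.quadratic_reciprocity_one_mod_four hp hd_odd, h_mul]

/-- Integers congruent to `1` or `3` modulo `8` are sums of three squares. -/
theorem exists_sum_three_sq {n : ℤ} (hn : 0 ≤ n) (h : n % 8 = 1 ∨ n % 8 = 3) :
    ∃ x y z : ℤ, x ^ 2 + y ^ 2 + z ^ 2 = n := by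
  lift n to ℕ using hn
  obtain ⟨c, r, hr, hc, hr4⟩ : ∃ c r : ℕ, 2 * r + 1 = c * n ∧ (c = 1 ∨ c = 3) ∧ r % 4 = 1 := by
    rcases h with h | h
    · exact ⟨3, (3 * n - 1) / 2, by omega, by omega, by omega⟩
    · exact ⟨1, (n - 1) / 2, by omega, by omega, by omega⟩
  have hcop : r.Coprime (4 * n) := by
    refine Nat.Coprime.mul_right ?_ ?_
    · rw [show 4 = 2 ^ 2 by rfl]
      exact (Nat.coprime_two_right.2 (Nat.odd_iff.2 (by omega))).pow_right 2
    · refine Nat.Coprime.symm (Nat.coprime_of_dvd fun k hk hkn hkr => hk.one_lt.ne' ?_)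
      have h₁ : k ∣ 2 * r + 1 := hr ▸ hkn.mul_left c
      exact Nat.dvd_one.1 ((Nat.dvd_add_right (hkr.mul_left 2)).1 h₁)
  obtain ⟨p, hp_gt, hp, hpr⟩ :=
    Nat.forall_exists_prime_gt_and_modEq r (q := 4 * n) (by omega) hcop
  obtain ⟨j, hj⟩ := (Nat.modEq_iff_dvd' hp_gt.le).1 hpr.symm
  have hpj : p = 4 * n * j + r := by omega
  have hp4 : p % 4 = 1 := by rw [hpj, mul_assoc]; omega
  have hd : 2 * p + 1 = (8 * j + c) * n := by rw [hpj]; linear_combination hr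
  have hJ := jacobiSym_neg_eq_one (d := 8 * j + c) hp4 (by omega) hd
  have := Fact.mk hp
  obtain ⟨s, hs⟩ := ZMod.isSquare_of_jacobiSym_eq_one hJ
  obtain ⟨s, rfl⟩ := ZMod.intCast_surjective s
  have hps : (p : ℤ) ∣ s ^ 2 + (8 * j + c : ℕ) := by
    rw [← ZMod.intCast_zmod_eq_zero_iff_dvd]
    push_cast at hs ⊢
    linear_combination -hs
  obtain ⟨t, ht, hpt⟩ : ∃ t : ℤ, t % 2 = 1 ∧ (p : ℤ) ∣ t ^ 2 + (8 * j + c : ℕ) := by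
    rcases Int.emod_two_eq_zero_or_one s with hs | hs
    · refine ⟨s + p, by omega, ?_⟩
      have := hps.add (Dvd.intro (2 * s + p : ℤ) rfl)
      rwa [show s ^ 2 + (8 * j + c : ℕ) + p * (2 * s + p) = (s + p) ^ 2 + (8 * j + c : ℕ) by
        ring] at this
    · exact ⟨s, hs, hps⟩
  have h_two : (2 : ℤ) ∣ t ^ 2 + (8 * j + c : ℕ) := by
    have : t ^ 2 % 2 = 1 := by simp [pow_two, Int.mul_emod, ht]
    omega
  have h_cop : IsCoprime (2 : ℤ) p := by
    rw [Int.isCoprime_iff_gcd_eq_one]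
    exact Nat.coprime_two_left.2 (Nat.odd_iff.2 (by omega))
  have hd_int : ((8 * j + c : ℕ) : ℤ) * n - 1 = 2 * p := by
    rw [← Nat.cast_mul, ← hd]; push_cast; ring
  refine exists_sum_three_sq_of_dvd (d := (8 * j + c : ℕ)) (s := t) (by omega) ?_ ?_
  · rw [hd_int]; have := hp.pos; omega
  · rw [hd_int]; exact h_cop.mul_dvd h_two hpt

theorem Int.sq_emod_eight (t : ℤ) : (t % 2 = 0 ∧ (t ^ 2 % 8 = 0 ∨ t ^ 2 % 8 = 4)) ∨
    (t % 2 = 1 ∧ t ^ 2 % 8 = 1) := by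
  have : t % 8 = 0 ∨ t % 8 = 1 ∨ t % 8 = 2 ∨ t % 8 = 3 ∨ t % 8 = 4 ∨ t % 8 = 5 ∨ t % 8 = 6 ∨
    t % 8 = 7 := by omega
  rcases this with h | h | h | h | h | h | h | h <;>
    simp [pow_two, Int.mul_emod, h] <;> omega

theorem exists_sq_add_two_mul_sq_add_of_mod_eight_eq_three {n : ℤ} (hn : 0 ≤ n) (h : n % 8 = 3) :
    ∃ x y z : ℤ, x ^ 2 + 2 * y ^ 2 + 32 * z ^ 2 = n := by
  have key : ∀ b c : ℤ, (8 ∣ b - c ∨ 8 ∣ b + c) →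
      ∃ y z : ℤ, b ^ 2 + c ^ 2 = 2 * y ^ 2 + 32 * z ^ 2 := by
    rintro b c (⟨v, hv⟩ | ⟨v, hv⟩)
    · exact ⟨b - 4 * v, v, by rw [show c = b - 8 * v by linarith]; ring⟩
    · exact ⟨b - 4 * v, v, by rw [show c = 8 * v - b by linarith]; ring⟩
  obtain ⟨a, b, c, rfl⟩ := exists_sum_three_sq hn (.inr h)
  have ha := Int.sq_emod_eight a
  have hb := Int.sq_emod_eight b
  have hc := Int.sq_emod_eight c
  -- two of three odd integers agree up to sign modulo 8
  have : (8 ∣ b - c ∨ 8 ∣ b + c) ∨ (8 ∣ a - c ∨ 8 ∣ a + c) ∨ (8 ∣ a - b ∨ 8 ∣ a + b) := by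
    have ha : a % 2 = 1 := by omega
    have hb : b % 2 = 1 := by omega
    have hc : c % 2 = 1 := by omega
    clear h key
    omega
  rcases this with h | h | h
  · obtain ⟨y, z, hyz⟩ := key b c h
    exact ⟨a, y, z, by linarith⟩
  · obtain ⟨y, z, hyz⟩ := key a c h
    exact ⟨b, y, z, by linarith⟩
  · obtain ⟨y, z, hyz⟩ := key a b h
    exact ⟨c, y, z, by linarith⟩

theorem exists_sq_add_eight_mul_sq_add_sq {n : ℤ} (hn : 0 ≤ n) (h : n % 8 = 1) :
    ∃ x y z : ℤ, x ^ 2 + 8 * y ^ 2 + 8 * z ^ 2 = n := by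
  have key : ∀ a b c : ℤ, a ^ 2 + b ^ 2 + c ^ 2 = n → b % 2 = 0 → c % 2 = 0 → a % 2 = 1 →
      ∃ x y z : ℤ, x ^ 2 + 8 * y ^ 2 + 8 * z ^ 2 = n := by
    intro a b c habc hb hc ha
    obtain ⟨b, rfl⟩ := Int.dvd_of_emod_eq_zero hb
    obtain ⟨c, rfl⟩ := Int.dvd_of_emod_eq_zero hc
    have ha_sq := Int.sq_emod_eight a
    have hbc : (b ^ 2 + c ^ 2) % 2 = 0 := by
      have : a ^ 2 + 4 * (b ^ 2 + c ^ 2) = n := by linarith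
      omega
    have : (b + c) % 2 = 0 := by
      rcases Int.emod_two_eq_zero_or_one b with h₁ | h₁ <;>
      rcases Int.emod_two_eq_zero_or_one c with h₂ | h₂ <;>
        simp [pow_two, Int.add_emod, Int.mul_emod, h₁, h₂] at hbc ⊢
    obtain ⟨u, hu⟩ := Int.dvd_of_emod_eq_zero this
    exact ⟨a, u, u - c, by rw [← habc, show b = 2 * u - c by linarith]; ring⟩
  obtain ⟨a, b, c, habc⟩ := exists_sum_three_sq hn (.inl h)
  have ha := Int.sq_emod_eight a
  have hb := Int.sq_emod_eight b
  have hc := Int.sq_emod_eight c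
  have : (a % 2 = 1 ∧ b % 2 = 0 ∧ c % 2 = 0) ∨ (a % 2 = 0 ∧ b % 2 = 1 ∧ c % 2 = 0) ∨
      (a % 2 = 0 ∧ b % 2 = 0 ∧ c % 2 = 1) := by omega
  rcases this with ⟨h₁, h₂, h₃⟩ | ⟨h₁, h₂, h₃⟩ | ⟨h₁, h₂, h₃⟩
  · exact key a b c habc h₂ h₃ h₁
  · exact key b a c (by linarith) h₁ h₃ h₂
  · exact key c a b (by linarith) h₁ h₂ h₃

/-- Away from the class `1` modulo `3`, the reflection in `(1, 1, 1)` makes one of the last two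
coordinates even. -/
theorem exists_sq_add_two_mul_sq_add_of_mod_three {n : ℤ} (hn : 0 ≤ n) (h : n % 8 = 1)
    (h3 : n % 3 ≠ 1) : ∃ x y z : ℤ, x ^ 2 + 2 * y ^ 2 + 32 * z ^ 2 = n := by
  obtain ⟨a, u, v, huv⟩ := exists_sq_add_eight_mul_sq_add_sq hn h
  have of_even : ∀ a u v : ℤ, a ^ 2 + 8 * u ^ 2 + 8 * v ^ 2 = n → u % 2 = 0 →
      ∃ x y z : ℤ, x ^ 2 + 2 * y ^ 2 + 32 * z ^ 2 = n := by
    intro a u v huv hu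
    obtain ⟨u, rfl⟩ := Int.dvd_of_emod_eq_zero hu
    exact ⟨a, 2 * v, u, by linarith⟩
  have of_dvd : ∀ a u v : ℤ, a ^ 2 + 8 * u ^ 2 + 8 * v ^ 2 = n → 3 ∣ a + u →
      ∃ x y z : ℤ, x ^ 2 + 2 * y ^ 2 + 32 * z ^ 2 = n := by
    intro a u v huv hau
    obtain ⟨s, hs⟩ : 3 ∣ a + 4 * u := by omega
    rcases Int.emod_two_eq_zero_or_one u with hu | hu
    · exact of_even a u v huv hu
    · have ha : a % 2 = 1 := by
        have : a ^ 2 % 2 = 1 := by omega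
        rcases Int.emod_two_eq_zero_or_one a with ha | ha
        · simp [pow_two, Int.mul_emod, ha] at this
        · exact ha
      refine of_even (a - 2 * s) (u - s) v ?_ (by omega)
      rw [← huv, show a = 3 * s - 4 * u by linarith]; ring
  have h_sq : ∀ t : ℤ, (t % 3 = 0 ∧ t ^ 2 % 3 = 0) ∨
      ((t % 3 = 1 ∨ t % 3 = 2) ∧ t ^ 2 % 3 = 1) := fun t => by
    have : t % 3 = 0 ∨ t % 3 = 1 ∨ t % 3 = 2 := by omega
    rcases this with h | h | h <;> simp [pow_two, Int.mul_emod, h]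
  have ha := h_sq a
  have hu := h_sq u
  have hv := h_sq v
  have : 3 ∣ a + u ∨ 3 ∣ a + -u ∨ 3 ∣ a + v ∨ 3 ∣ a + -v := by omega
  rcases this with h | h | h | h
  · exact of_dvd a u v huv h
  · exact of_dvd a (-u) v (by linarith [neg_sq u]) h
  · exact of_dvd a v u (by linarith) h
  · exact of_dvd a (-v) u (by linarith [neg_sq v]) h

theorem exists_rep_of_mod_eight {n : ℤ} (hn : 0 ≤ n) (h : n % 8 = 1 ∨ n % 8 = 3) :
    ∃ x y z w : ℤ, x ^ 2 + 2 * y ^ 2 + 32 * z ^ 2 + 64 * w ^ 2 = n := by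
  rcases h with h | h
  · by_cases h3 : n % 3 = 1
    · by_cases h64 : n < 64
      · have : n = 1 ∨ n = 25 ∨ n = 49 := by omega
        rcases this with rfl | rfl | rfl
        exacts [⟨1, 0, 0, 0, by norm_num⟩, ⟨5, 0, 0, 0, by norm_num⟩, ⟨7, 0, 0, 0, by norm_num⟩]
      · obtain ⟨x, y, z, h⟩ := exists_sq_add_two_mul_sq_add_of_mod_three (n := n - 64)
          (by omega) (by omega) (by omega)
        exact ⟨x, y, z, 1, by linarith⟩
    · obtain ⟨x, y, z, h⟩ := exists_sq_add_two_mul_sq_add_of_mod_three hn h h3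
      exact ⟨x, y, z, 0, by linarith⟩
  · obtain ⟨x, y, z, h⟩ := exists_sq_add_two_mul_sq_add_of_mod_eight_eq_three hn h
    exact ⟨x, y, z, 0, by linarith⟩

theorem exists_sq_add_two_mul_sq_add_eight_mul_sq {n : ℤ} (hn : 0 ≤ n)
    (h : n % 8 = 1 ∨ n % 8 = 3) : ∃ x y z : ℤ, x ^ 2 + 2 * y ^ 2 + 8 * z ^ 2 = n := by
  rcases h with h | h
  · obtain ⟨x, y, z, h⟩ := exists_sq_add_eight_mul_sq_add_sq hn h
    exact ⟨x, 2 * y, z, by linarith⟩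
  · obtain ⟨x, y, z, h⟩ := exists_sq_add_two_mul_sq_add_of_mod_eight_eq_three hn h
    exact ⟨x, y, 2 * z, by linarith⟩

theorem exists_rep_of_odd {n : ℤ} (hn : 0 ≤ n) (h : n % 2 = 1) :
    ∃ x y z w : ℤ, x ^ 2 + 2 * y ^ 2 + 8 * z ^ 2 + 4 * w ^ 2 = n := by
  by_cases h8 : n % 8 = 1 ∨ n % 8 = 3
  · obtain ⟨x, y, z, h⟩ := exists_sq_add_two_mul_sq_add_eight_mul_sq hn h8
    exact ⟨x, y, z, 0, by linarith⟩
  · obtain ⟨x, y, z, h⟩ := exists_sq_add_two_mul_sq_add_eight_mul_sq (n := n - 4)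
      (by omega) (by omega)
    exact ⟨x, y, z, 1, by linarith⟩

/-- The form `x² + y² + 2 z² + 2 w²` is universal. -/
theorem exists_rep_one_one_two_two {n : ℤ} (hn : 0 ≤ n) :
    ∃ x y z w : ℤ, x ^ 2 + y ^ 2 + 2 * z ^ 2 + 2 * w ^ 2 = n := by
  lift n to ℕ using hn
  obtain ⟨a, b, c, d, h⟩ := Nat.sum_four_squares n
  have key : ∀ a b c d : ℤ, a ^ 2 + b ^ 2 + c ^ 2 + d ^ 2 = n → (c + d) % 2 = 0 →
      ∃ x y z w : ℤ, x ^ 2 + y ^ 2 + 2 * z ^ 2 + 2 * w ^ 2 = n := by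
    intro a b c d h hcd
    obtain ⟨u, hu⟩ := Int.dvd_of_emod_eq_zero hcd
    exact ⟨a, b, u, u - d, by rw [← h, show c = 2 * u - d by linarith]; ring⟩
  zify at h
  have : ((c : ℤ) + d) % 2 = 0 ∨ ((b : ℤ) + d) % 2 = 0 ∨ ((b : ℤ) + c) % 2 = 0 := by omega
  rcases this with h₁ | h₁ | h₁
  · exact key a b c d h h₁
  · exact key a c b d (by linarith) h₁
  · exact key a d b c (by linarith) h₁

/-- The form `x² + 2 y² + 4 z² + 8 w²` is universal. -/
theorem exists_rep_one_two_four_eight {n : ℤ} (hn : 0 ≤ n) :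
    ∃ x y z w : ℤ, x ^ 2 + 2 * y ^ 2 + 4 * z ^ 2 + 8 * w ^ 2 = n := by
  by_cases h₁ : n % 2 = 1
  · obtain ⟨x, y, z, w, h⟩ := exists_rep_of_odd hn h₁
    exact ⟨x, y, w, z, by linarith⟩
  by_cases h₂ : n % 4 = 2
  · obtain ⟨x, y, z, w, h⟩ := exists_rep_of_odd (n := n / 2) (by omega) (by omega)
    exact ⟨2 * y, x, 2 * z, w, by
      linarith [show n = 2 * (n / 2) by omega]⟩
  · obtain ⟨x, y, z, w, h⟩ := exists_rep_one_one_two_two (n := n / 4) (by omega)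
    exact ⟨2 * x, 2 * z, y, w, by
      linarith [show n = 4 * (n / 4) by omega]⟩

theorem Int.sq_emod_thirty_two (t : ℤ) : t ^ 2 % 32 = 0 ∨ t ^ 2 % 32 = 1 ∨ t ^ 2 % 32 = 4 ∨
    t ^ 2 % 32 = 9 ∨ t ^ 2 % 32 = 16 ∨ t ^ 2 % 32 = 17 ∨ t ^ 2 % 32 = 25 := by
  have h₀ := Int.emod_nonneg t (show (32 : ℤ) ≠ 0 by norm_num)
  have h₁ := Int.emod_lt_of_pos t (show (0 : ℤ) < 32 by norm_num)
  rw [pow_two, Int.mul_emod]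
  generalize t % 32 = r at *
  interval_cases r <;> norm_num

theorem stmt_4 (n : ℤ) (hn : 0 ≤ n) :
    (∃ x1 x2 y1 y2 : ℤ, x1^2 + 2*x2^2 + 32*y1^2 + 64*y2^2 = n) ↔
    (n % 8 = 0 ∨ n % 8 = 1 ∨ n % 8 = 3 ∨ n % 16 = 2 ∨ n % 16 = 6 ∨ n % 32 = 4 ∨ n % 32 = 12) := by
  constructor
  · rintro ⟨x, y, z, w, h⟩
    have hx := Int.sq_emod_thirty_two x
    have hy := Int.sq_emod_thirty_two y
    omega
  · intro h
    by_cases h₀ : n % 8 = 0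
    · obtain ⟨x, y, z, w, h⟩ := exists_rep_one_two_four_eight (n := n / 8) (by omega)
      exact ⟨4 * y, 2 * x, z, w, by linarith [show n = 8 * (n / 8) by omega]⟩
    by_cases h₁ : n % 2 = 1
    · exact exists_rep_of_mod_eight hn (by omega)
    by_cases h₂ : n % 4 = 2
    · obtain ⟨x, y, z, w, h⟩ := exists_rep_of_mod_eight (n := n / 2) (by omega) (by omega)
      exact ⟨2 * y, x, 2 * w, z, by linarith [show n = 2 * (n / 2) by omega]⟩
    · obtain ⟨x, y, z, w, h⟩ := exists_rep_of_mod_eight (n := n / 4) (by omega) (by omega)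
      exact ⟨2 * x, 2 * y, 2 * z, 2 * w, by linarith [show n = 4 * (n / 4) by omega]⟩
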